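/- Let p ∈ (1, 2], and let F: ℝ^d → ℝ^d be L-Lipschitz with respect to ‖·‖_p (i.e., ‖F(u) - F(v)‖_{p*} ≤ L‖u - v‖_p) with a Minty solution u* (so ⟨F(u), u - u*⟩ ≥ 0 for all u and F(u*) = 0). Run EG_p+ with exact gradients, β = m_p = p-1, a_k = m_p^{3/2}/(2L). Then for all k ≥ 0: (1/(k+1))·Σ_{i=0}^{k} ‖F(u_i)‖_{p*}² ≤ 16 L² φ_p(u*, u₀) / (m_p² (k+1)), where φ_p(u*, u₀) = (1/2)‖u* - u₀‖_p². -/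

import Mathlib

noncomputable def lpNorm {d : ℕ} (p : ℝ) (x : Fin d → ℝ) : ℝ :=
  (∑ i, |x i| ^ p) ^ (1 / p)

open Real Filter Topology

lemma rpow_sub_ge {q t : ℝ} (hq0 : 0 < q) (hq1 : q ≤ 1) (ht0 : 0 ≤ t) (ht1 : t ≤ 1) :
    2 * q * t ≤ (1 + t) ^ q - (1 - t) ^ q := by
  have hmono : MonotoneOn (fun s : ℝ => (1 + s) ^ q - (1 - s) ^ q - 2 * q * s)
      (Set.Icc 0 1) := by
    have hd : ∀ s ∈ Set.Ioo (0 : ℝ) 1,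
        HasDerivAt (fun s : ℝ => (1 + s) ^ q - (1 - s) ^ q - 2 * q * s)
          (1 * q * (1 + s) ^ (q - 1) - (-1) * q * (1 - s) ^ (q - 1) - 2 * q * 1) s := by
      intro s hs
      have h1 : HasDerivAt (fun s : ℝ => 1 + s) 1 s := (hasDerivAt_id s).const_add 1
      have h2 : HasDerivAt (fun s : ℝ => 1 - s) (-1) s := (hasDerivAt_id s).const_sub 1
      exact ((h1.rpow_const (Or.inl (by linarith [hs.1]))).sub
        (h2.rpow_const (Or.inl (by linarith [hs.2])))).sub ((hasDerivAt_id s).const_mul (2 * q))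
    refine monotoneOn_of_deriv_nonneg (convex_Icc 0 1) ?_ ?_ ?_
    · refine ContinuousOn.sub (ContinuousOn.sub ?_ ?_) (by fun_prop)
      · exact ContinuousOn.rpow_const (by fun_prop) fun x _ => Or.inr hq0.le
      · exact ContinuousOn.rpow_const (by fun_prop) fun x _ => Or.inr hq0.le
    · rw [interior_Icc]
      exact fun s hs => (hd s hs).differentiableAt.differentiableWithinAt
    · rw [interior_Icc]
      intro s hs
      rw [(hd s hs).deriv]
      obtain ⟨hs0, hs1⟩ := hs
      set A := (1 + s) ^ (q - 1) with hA
      set B := (1 - s) ^ (q - 1) with hB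
      have hApos : 0 < A := rpow_pos_of_pos (by linarith) _
      have hBpos : 0 < B := rpow_pos_of_pos (by linarith) _
      have hAB : 1 ≤ A * B := by
        rw [hA, hB, ← mul_rpow (by linarith) (by linarith)]
        exact one_le_rpow_of_pos_of_le_one_of_nonpos (by nlinarith) (by nlinarith) (by linarith)
      have h2 : 2 ≤ A + B := by nlinarith [sq_nonneg (A - B)]
      nlinarith
  have h := hmono (Set.left_mem_Icc.2 zero_le_one) ⟨ht0, ht1⟩ ht0
  simp at h
  linarith

lemma two_mul_one_add_le_rpow_add_rpow {p t : ℝ} (hp1 : 1 < p) (hp2 : p ≤ 2)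
    (ht0 : 0 ≤ t) (ht1 : t ≤ 1) :
    2 + p * (p - 1) * t ^ 2 ≤ (1 + t) ^ p + (1 - t) ^ p := by
  have hmono : MonotoneOn (fun s : ℝ => (1 + s) ^ p + (1 - s) ^ p - p * (p - 1) * s ^ 2)
      (Set.Icc 0 1) := by
    have hd : ∀ s : ℝ,
        HasDerivAt (fun s : ℝ => (1 + s) ^ p + (1 - s) ^ p - p * (p - 1) * s ^ 2)
          (1 * p * (1 + s) ^ (p - 1) + (-1) * p * (1 - s) ^ (p - 1)
            - p * (p - 1) * (2 * s)) s := by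
      intro s
      have h1 : HasDerivAt (fun s : ℝ => 1 + s) 1 s := (hasDerivAt_id s).const_add 1
      have h2 : HasDerivAt (fun s : ℝ => 1 - s) (-1) s := (hasDerivAt_id s).const_sub 1
      have h3 : HasDerivAt (fun s : ℝ => s ^ 2) (2 * s) s := by
        simpa using hasDerivAt_pow 2 s
      exact ((h1.rpow_const (Or.inr hp1.le)).add
        (h2.rpow_const (Or.inr hp1.le))).sub (h3.const_mul (p * (p - 1)))
    refine monotoneOn_of_deriv_nonneg (convex_Icc 0 1)
      (fun s _ => (hd s).continuousAt.continuousWithinAt)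
      (fun s _ => (hd s).differentiableAt.differentiableWithinAt) ?_
    rw [interior_Icc]
    intro s hs
    rw [(hd s).deriv]
    have := rpow_sub_ge (q := p - 1) (by linarith) (by linarith) hs.1.le hs.2.le
    nlinarith
  have h := hmono (Set.left_mem_Icc.2 zero_le_one) ⟨ht0, ht1⟩ ht0
  simp at h
  linarith

lemma two_point_of_le {p a b : ℝ} (hp1 : 1 < p) (hp2 : p ≤ 2) (hb : 0 ≤ b) (hba : b ≤ a) :
    2 * (a ^ 2 + (p - 1) * b ^ 2) ^ (p / 2) ≤ (a + b) ^ p + (a - b) ^ p := by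
  rcases hb.eq_or_lt with rfl | hb'
  · have : (a ^ 2) ^ (p / 2) = a ^ p := by
      rw [← rpow_natCast, ← rpow_mul hba]; congr 1; push_cast; ring
    simp [this, two_mul]
  have ha : 0 < a := hb'.trans_le hba
  have ht0 : 0 ≤ b / a := by positivity
  have ht1 : b / a ≤ 1 := (div_le_one ha).2 hba
  have hA : (a ^ 2) ^ (p / 2) = a ^ p := by
    rw [← rpow_natCast, ← rpow_mul ha.le]; congr 1; push_cast; ring
  have e1 : (a + b) ^ p = a ^ p * (1 + b / a) ^ p := by
    rw [← mul_rpow ha.le (by positivity)]; congr 1; field_simp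
  have e2 : (a - b) ^ p = a ^ p * (1 - b / a) ^ p := by
    rw [← mul_rpow ha.le (by linarith)]; congr 1; field_simp
  have e3 : (a ^ 2 + (p - 1) * b ^ 2) ^ (p / 2)
      = a ^ p * (1 + (p - 1) * (b / a) ^ 2) ^ (p / 2) := by
    rw [← hA, ← mul_rpow (by positivity) (by nlinarith [sq_nonneg (b / a)])]
    congr 1; field_simp
  have hbern : (1 + (p - 1) * (b / a) ^ 2) ^ (p / 2) ≤ 1 + p / 2 * ((p - 1) * (b / a) ^ 2) :=
    rpow_one_add_le_one_add_mul_self (by nlinarith [sq_nonneg (b / a)]) (by linarith)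
      (by linarith)
  have := two_mul_one_add_le_rpow_add_rpow hp1 hp2 ht0 ht1
  rw [e1, e2, e3]
  have hap : 0 < a ^ p := rpow_pos_of_pos ha p
  nlinarith

/-- The two-point inequality behind the 2-uniform convexity of `ℓᵖ` for `1 < p ≤ 2`. -/
lemma two_point {p : ℝ} (hp1 : 1 < p) (hp2 : p ≤ 2) (a b : ℝ) :
    2 * (a ^ 2 + (p - 1) * b ^ 2) ^ (p / 2) ≤ |a + b| ^ p + |a - b| ^ p := by
  have key : ∀ a b : ℝ, 0 ≤ a → 0 ≤ b →
      2 * (a ^ 2 + (p - 1) * b ^ 2) ^ (p / 2) ≤ |a + b| ^ p + |a - b| ^ p := by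
    intro a b ha hb
    rw [abs_of_nonneg (add_nonneg ha hb)]
    rcases le_total b a with h | h
    · rw [abs_of_nonneg (sub_nonneg.2 h)]
      exact two_point_of_le hp1 hp2 hb h
    · rw [abs_sub_comm, abs_of_nonneg (sub_nonneg.2 h), add_comm a b]
      refine le_trans ?_ (two_point_of_le hp1 hp2 ha h)
      have h2 : a ^ 2 ≤ b ^ 2 := pow_le_pow_left₀ ha h 2
      have h3 : 0 ≤ p - 1 := by linarith
      gcongr 2 * ?_ ^ _
      nlinarith
  have h := key |a| |b| (abs_nonneg a) (abs_nonneg b)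
  rw [sq_abs, sq_abs] at h
  refine h.trans_eq ?_
  rcases abs_cases a with ⟨h1, -⟩ | ⟨h1, -⟩ <;> rcases abs_cases b with ⟨h2, -⟩ | ⟨h2, -⟩ <;>
    rw [h1, h2]
  · rw [add_comm, sub_neg_eq_add, ← sub_eq_add_neg]
  · rw [add_comm, show -a + b = -(a - b) by ring, show -a - b = -(a + b) by ring,
      abs_neg, abs_neg]
  · rw [show -a + -b = -(a + b) by ring, show -a - -b = -(a - b) by ring, abs_neg, abs_neg]

lemma sum_rpow_add_sum_rpow_le {ι : Type*} (s : Finset ι) {r : ℝ} (hr : 1 ≤ r) (A B : ι → ℝ)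
    (hA : ∀ i, 0 ≤ A i) (hB : ∀ i, 0 ≤ B i) :
    ((∑ i ∈ s, A i) ^ r + (∑ i ∈ s, B i) ^ r) ^ (1 / r)
      ≤ ∑ i ∈ s, (A i ^ r + B i ^ r) ^ (1 / r) := by
  classical
  have hr0 : r ≠ 0 := by linarith
  induction s using Finset.induction_on with
  | empty => simp [zero_rpow hr0, zero_rpow (inv_ne_zero hr0)]
  | insert i s hi ih =>
    rw [Finset.sum_insert hi, Finset.sum_insert hi, Finset.sum_insert hi]
    refine le_trans ?_ (add_le_add_right ih _)
    have h := Real.Lp_add_le_of_nonneg (Finset.univ : Finset (Fin 2))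
      (f := ![A i, B i]) (g := ![∑ i ∈ s, A i, ∑ i ∈ s, B i]) hr
      (by intro j _; fin_cases j <;> simp [hA, hB])
      (by intro j _; fin_cases j <;> simp [Finset.sum_nonneg, hA, hB])
    simpa [Fin.sum_univ_two] using h

lemma lpNorm_nonneg {d : ℕ} (p : ℝ) (x : Fin d → ℝ) : 0 ≤ lpNorm p x :=
  rpow_nonneg (Finset.sum_nonneg fun _ _ => rpow_nonneg (abs_nonneg _) _) _

lemma sum_abs_rpow_nonneg {d : ℕ} (p : ℝ) (x : Fin d → ℝ) : 0 ≤ ∑ i, |x i| ^ p :=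
  Finset.sum_nonneg fun _ _ => rpow_nonneg (abs_nonneg _) _

lemma lpNorm_sq {d : ℕ} (p : ℝ) (x : Fin d → ℝ) :
    lpNorm p x ^ 2 = (∑ i, |x i| ^ p) ^ (2 / p) := by
  rw [lpNorm, ← rpow_natCast, ← rpow_mul (sum_abs_rpow_nonneg p x)]
  congr 1; push_cast; ring

lemma lpNorm_smul {d : ℕ} {p : ℝ} (hp : 0 < p) (c : ℝ) (x : Fin d → ℝ) :
    lpNorm p (c • x) = |c| * lpNorm p x := by
  simp only [lpNorm, Pi.smul_apply, smul_eq_mul, abs_mul]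
  simp_rw [mul_rpow (abs_nonneg c) (abs_nonneg _)]
  rw [← Finset.mul_sum, mul_rpow (rpow_nonneg (abs_nonneg _) _) (sum_abs_rpow_nonneg p x),
    ← rpow_mul (abs_nonneg c), mul_one_div_cancel hp.ne', rpow_one]

lemma lpNorm_neg {d : ℕ} (p : ℝ) (x : Fin d → ℝ) : lpNorm p (-x) = lpNorm p x := by
  simp [lpNorm]

lemma lpNorm_sub_comm {d : ℕ} (p : ℝ) (x y : Fin d → ℝ) :
    lpNorm p (x - y) = lpNorm p (y - x) := by
  rw [← lpNorm_neg, neg_sub]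

/-- Two-uniform convexity of the `ℓᵖ` norm for `1 < p ≤ 2`, with the sharp constant. -/
lemma lpNorm_sq_add_le {d : ℕ} {p : ℝ} (hp1 : 1 < p) (hp2 : p ≤ 2) (x y : Fin d → ℝ) :
    2 * (lpNorm p x ^ 2 + (p - 1) * lpNorm p y ^ 2)
      ≤ lpNorm p (x + y) ^ 2 + lpNorm p (x - y) ^ 2 := by
  have hp0 : 0 < p := by linarith
  have hm : 0 < p - 1 := by linarith
  have hr : 1 ≤ 2 / p := by rw [le_div_iff₀ hp0]; linarith
  have hr0 : 0 < 2 / p := by linarith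
  have hpow : ∀ z : ℝ, (|z| ^ p) ^ (2 / p) = z ^ 2 := by
    intro z
    rw [← rpow_mul (abs_nonneg z), mul_div_cancel₀ _ hp0.ne']
    norm_num
  set c := √(p - 1) with hc
  have hcsq : c ^ 2 = p - 1 := sq_sqrt hm.le
  have h1 := sum_rpow_add_sum_rpow_le Finset.univ hr (fun i => |x i| ^ p)
    (fun i => |(c • y) i| ^ p) (fun i => rpow_nonneg (abs_nonneg _) _)
    (fun i => rpow_nonneg (abs_nonneg _) _)
  simp only [hpow] at h1
  rw [← lpNorm_sq, ← lpNorm_sq, lpNorm_smul hp0, mul_pow, sq_abs, hcsq, one_div_div] at h1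
  have h2 : ∑ i, (x i ^ 2 + (c • y) i ^ 2) ^ (p / 2)
      ≤ (1 / 2) * ∑ i, |(x + y) i| ^ p + (1 / 2) * ∑ i, |(x - y) i| ^ p := by
    rw [Finset.mul_sum, Finset.mul_sum, ← Finset.sum_add_distrib]
    refine Finset.sum_le_sum fun i _ => ?_
    have := two_point hp1 hp2 (x i) (y i)
    simp only [Pi.smul_apply, smul_eq_mul, mul_pow, hcsq, Pi.add_apply, Pi.sub_apply]
    linarith
  have hnn : 0 ≤ lpNorm p x ^ 2 + (p - 1) * lpNorm p y ^ 2 := by positivity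
  have h3 := rpow_le_rpow (rpow_nonneg hnn _) (h1.trans h2) hr0.le
  rw [← rpow_mul hnn, show p / 2 * (2 / p) = 1 by field_simp, rpow_one] at h3
  have h4 := (convexOn_rpow hr).2 (Set.mem_Ici.2 (sum_abs_rpow_nonneg p (x + y)))
    (Set.mem_Ici.2 (sum_abs_rpow_nonneg p (x - y)))
    (by norm_num : (0 : ℝ) ≤ 1 / 2) (by norm_num : (0 : ℝ) ≤ 1 / 2) (by norm_num)
  simp only [smul_eq_mul] at h4
  rw [← lpNorm_sq, ← lpNorm_sq] at h4
  linarith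

lemma differentiable_half_lpNorm_sq {d : ℕ} {p : ℝ} (hp1 : 1 < p) (hp2 : p ≤ 2)
    (c : Fin d → ℝ) :
    Differentiable ℝ (fun v : Fin d → ℝ => (1 / 2) * lpNorm p (v - c) ^ 2) := by
  have hr : 1 ≤ 2 / p := by rw [le_div_iff₀ (by linarith)]; linarith
  simp_rw [lpNorm_sq]
  refine Differentiable.const_mul ((differentiable_rpow_const hr).comp ?_) _
  refine Differentiable.fun_sum fun i _ => ?_
  have : Differentiable ℝ (fun v : Fin d → ℝ => (v - c) i) := by
    simp only [Pi.sub_apply]; fun_prop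
  simpa only [norm_eq_abs] using this.norm_rpow hp1

/-- A differentiable function that is midpoint strongly convex with modulus `m` along the
segment from `x` to `x + h` satisfies the first-order strong convexity inequality. -/
lemma first_order_of_midpoint {E : Type*} [NormedAddCommGroup E] [NormedSpace ℝ E]
    {f : E → ℝ} {x h : E} {N : ℝ} (hf : DifferentiableAt ℝ f x)
    (hmid : ∀ t : ℝ, f (x + (t / 2) • h) ≤ (f x + f (x + t • h)) / 2 - t ^ 2 * N / 4) :
    f x + fderiv ℝ f x h + N ≤ f (x + h) := by
  have hline : HasDerivAt (fun t : ℝ => f (x + t • h)) (fderiv ℝ f x h) 0 := by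
    have h1 : HasDerivAt (fun t : ℝ => x + t • h) h 0 := by
      simpa using ((hasDerivAt_id (0 : ℝ)).smul_const h).const_add x
    have h2 : HasFDerivAt f (fderiv ℝ f x) (x + (0 : ℝ) • h) := by
      simpa using hf.hasFDerivAt
    exact h2.comp_hasDerivAt (0 : ℝ) h1
  have hq : ∀ n : ℕ, (2 : ℝ) ^ n * (f (x + ((1 / 2 : ℝ) ^ n) • h) - f x)
      ≤ f (x + h) - f x - N * (1 - (1 / 2) ^ n) := by
    intro n
    induction n with
    | zero => simp
    | succ n ih =>
      have h1 := hmid ((1 / 2) ^ n)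
      rw [show ((1 / 2 : ℝ) ^ n) / 2 = (1 / 2) ^ (n + 1) by ring] at h1
      have hpos : (0 : ℝ) < 2 ^ n := by positivity
      have hinv : (2 : ℝ) ^ n * (1 / 2) ^ n = 1 := by rw [← mul_pow]; norm_num
      have h2 := mul_le_mul_of_nonneg_left h1 hpos.le
      have h3 : (2 : ℝ) ^ n * (((1 / 2) ^ n) ^ 2 * N / 4) = (1 / 2) ^ n * N / 4 := by
        linear_combination ((1 / 2) ^ n * N / 4) * hinv
      rw [pow_succ (2 : ℝ), pow_succ (1 / 2 : ℝ)] at *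
      nlinarith
  have hlim0 : Tendsto (fun n : ℕ => (1 / 2 : ℝ) ^ n) atTop (𝓝 0) :=
    tendsto_pow_atTop_nhds_zero_of_lt_one (by norm_num) (by norm_num)
  have hlimL : Tendsto (fun n : ℕ => (2 : ℝ) ^ n * (f (x + ((1 / 2 : ℝ) ^ n) • h) - f x))
      atTop (𝓝 (fderiv ℝ f x h)) := by
    have h1 := hline.tendsto_slope_zero
    have h2 : Tendsto (fun n : ℕ => (1 / 2 : ℝ) ^ n) atTop (𝓝[≠] 0) :=
      tendsto_nhdsWithin_iff.2 ⟨hlim0, Eventually.of_forall fun n => by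
        simp⟩
    refine (h1.comp h2).congr fun n => ?_
    simp
  have hlimR : Tendsto (fun n : ℕ => f (x + h) - f x - N * (1 - (1 / 2 : ℝ) ^ n)) atTop
      (𝓝 (f (x + h) - f x - N * (1 - 0))) :=
    (((hlim0.const_sub 1).const_mul N).const_sub _)
  have := le_of_tendsto_of_tendsto' hlimL hlimR hq
  linarith

/-- First-order strong convexity of half the squared `ℓᵖ` distance, with constant `p - 1`. -/
lemma half_lpNorm_sq_first_order {d : ℕ} {p : ℝ} (hp1 : 1 < p) (hp2 : p ≤ 2)
    (c x y : Fin d → ℝ) :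
    (1 / 2) * lpNorm p (x - c) ^ 2
        + fderiv ℝ (fun v : Fin d → ℝ => (1 / 2) * lpNorm p (v - c) ^ 2) x (y - x)
        + (p - 1) / 2 * lpNorm p (y - x) ^ 2
      ≤ (1 / 2) * lpNorm p (y - c) ^ 2 := by
  have h := first_order_of_midpoint (h := y - x) (N := (p - 1) / 2 * lpNorm p (y - x) ^ 2)
    (differentiable_half_lpNorm_sq hp1 hp2 c x) ?_
  · simpa using h
  · intro t
    have h1 := lpNorm_sq_add_le hp1 hp2 ((x + (t / 2) • (y - x)) - c) ((t / 2) • (y - x))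
    rw [lpNorm_smul (by linarith), mul_pow, sq_abs,
      show x + (t / 2) • (y - x) - c + (t / 2) • (y - x) = x + t • (y - x) - c by module,
      show x + (t / 2) • (y - x) - c - (t / 2) • (y - x) = x - c by module] at h1
    linarith

/-- Hölder's inequality for `lpNorm`. -/
lemma abs_dot_le {d : ℕ} {p : ℝ} (hp1 : 1 < p) (g w : Fin d → ℝ) :
    |∑ i, g i * w i| ≤ lpNorm (p / (p - 1)) g * lpNorm p w := by
  have hpq : (p / (p - 1)).HolderConjugate p :=
    (Real.HolderConjugate.conjExponent hp1).symm
  refine abs_le'.2 ⟨inner_le_Lp_mul_Lq _ g w hpq, ?_⟩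
  rw [← lpNorm_neg p w, ← Finset.sum_neg_distrib]
  simpa [lpNorm] using inner_le_Lp_mul_Lq Finset.univ g (-w) hpq

/-- The dual norm is attained. -/
lemma exists_dot_eq_lpNorm {d : ℕ} {p : ℝ} (hp1 : 1 < p) (g : Fin d → ℝ) :
    ∃ w : Fin d → ℝ, lpNorm p w ≤ 1 ∧ ∑ i, g i * w i = lpNorm (p / (p - 1)) g := by
  have hpq : (p / (p - 1)).HolderConjugate p :=
    (Real.HolderConjugate.conjExponent hp1).symm
  obtain ⟨w, hw, hgw⟩ := (NNReal.isGreatest_Lp Finset.univ (fun i => Real.nnabs (g i)) hpq).1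
  refine ⟨fun i => SignType.sign (g i) * w i, ?_, ?_⟩
  · have hw' : ∑ i, (w i : ℝ) ^ p ≤ 1 := by exact_mod_cast hw
    refine rpow_le_one (sum_abs_rpow_nonneg p _) (le_trans ?_ hw') (by positivity)
    refine Finset.sum_le_sum fun i _ => ?_
    refine rpow_le_rpow (abs_nonneg _) ?_ (by linarith)
    rw [abs_mul, NNReal.abs_eq]
    refine mul_le_of_le_one_left (w i).2 ?_
    rcases lt_trichotomy (g i) 0 with h | h | h <;> simp [h]
  · have h := congrArg NNReal.toReal hgw
    push_cast [Real.coe_nnabs] at h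
    rw [lpNorm, ← h]
    refine Finset.sum_congr rfl fun i _ => ?_
    rw [← mul_assoc, self_mul_sign]

lemma apply_eq_sum_single {d : ℕ} (D : (Fin d → ℝ) →L[ℝ] ℝ) (x : Fin d → ℝ) :
    ∑ i, D (Pi.single i 1) * x i = D x := by
  conv_rhs => rw [pi_eq_sum_univ' x, map_sum]
  refine Finset.sum_congr rfl fun i _ => ?_
  rw [map_smul, smul_eq_mul, mul_comm]

/-- The continuous linear functional `v ↦ ∑ i, g i * v i`. -/
noncomputable def dotCLM {d : ℕ} (g : Fin d → ℝ) : (Fin d → ℝ) →L[ℝ] ℝ :=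
  ∑ i, g i • ContinuousLinearMap.proj i

@[simp] lemma dotCLM_apply {d : ℕ} (g v : Fin d → ℝ) : dotCLM g v = ∑ i, g i * v i := by
  simp [dotCLM]

/-- First-order optimality for a linear functional plus half the squared `ℓᵖ` distance. -/
lemma fderiv_eq_neg_of_isMinOn {d : ℕ} {p : ℝ} (hp1 : 1 < p) (hp2 : p ≤ 2)
    {c w x : Fin d → ℝ} {C : ℝ} {l : (Fin d → ℝ) →L[ℝ] ℝ}
    (h : IsMinOn (fun v => l (v - w) + (1 / 2) * lpNorm p (v - c) ^ 2 + C) Set.univ x) :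
    fderiv ℝ (fun v : Fin d → ℝ => (1 / 2) * lpNorm p (v - c) ^ 2) x = -l := by
  have h1 : HasFDerivAt (fun v => l (v - w)) l x :=
    (l.hasFDerivAt (x := x - w)).comp x ((hasFDerivAt_id x).sub_const w)
  have h2 := ((h1.add (differentiable_half_lpNorm_sq hp1 hp2 c x).hasFDerivAt).add_const C)
  have h3 := (h.isLocalMin univ_mem).hasFDerivAt_eq_zero h2
  exact eq_neg_of_add_eq_zero_right h3

/-- The extrapolation step: its length is the dual norm of `g`, and the minimized objective
grows quadratically away from the minimizer. -/
lemma extrapolation_step {d : ℕ} {p : ℝ} (hp1 : 1 < p) (hp2 : p ≤ 2) {g x y : Fin d → ℝ}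
    (h : IsMinOn (fun v => dotCLM g (v - x) + (1 / 2) * lpNorm p (v - x) ^ 2) Set.univ y) :
    lpNorm p (y - x) = lpNorm (p / (p - 1)) g ∧
      ∀ v, dotCLM g (y - v) ≤ (1 / 2) * lpNorm p (v - x) ^ 2
        - (1 / 2) * lpNorm p (y - x) ^ 2 - (p - 1) / 2 * lpNorm p (v - y) ^ 2 := by
  constructor
  · obtain ⟨w, hw, hgw⟩ := exists_dot_eq_lpNorm hp1 g
    set N := lpNorm (p / (p - 1)) g
    have hN : 0 ≤ N := lpNorm_nonneg _ _
    have h1 := h (Set.mem_univ (x + (-N) • w))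
    simp only [Set.mem_ofPred_eq, add_sub_cancel_left, map_smul, smul_eq_mul,
      lpNorm_smul (by linarith : 0 < p), abs_neg, abs_of_nonneg hN] at h1
    rw [dotCLM_apply g w, hgw] at h1
    have h2 := (abs_le.1 (abs_dot_le hp1 g (y - x))).1
    rw [← dotCLM_apply] at h2
    have hw0 := lpNorm_nonneg p w
    have h3 : (N * lpNorm p w) ^ 2 ≤ N ^ 2 :=
      pow_le_pow_left₀ (by positivity) (mul_le_of_le_one_right hN hw) 2
    have h4 : (lpNorm p (y - x) - N) ^ 2 ≤ 0 := by nlinarith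
    have h5 := pow_eq_zero_iff (two_ne_zero) |>.1 (le_antisymm h4 (sq_nonneg _))
    linarith
  · intro v
    have h1 := half_lpNorm_sq_first_order hp1 hp2 x y v
    rw [fderiv_eq_neg_of_isMinOn hp1 hp2 (w := x) (C := 0) (by simpa only [add_zero] using h),
      neg_apply, ← map_neg, neg_sub] at h1
    linarith

theorem stmt_12 {d : ℕ} (p L : ℝ) (hp1 : 1 < p) (hp2 : p ≤ 2) (hL : 0 < L)
    (F : (Fin d → ℝ) → Fin d → ℝ)
    (hLip : ∀ u v, lpNorm (p / (p - 1)) (F u - F v) ≤ L * lpNorm p (u - v))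
    (ustar : Fin d → ℝ) (hzero : F ustar = 0)
    (hminty : ∀ u, (∑ i, F u i * (u i - ustar i)) ≥ 0)
    (u0 : Fin d → ℝ) (u ubar : ℕ → Fin d → ℝ) (hu0 : u 0 = u0)
    (mp a β : ℝ) (hmp : mp = p - 1) (hβ : β = mp)
    (ha : a = mp ^ ((3 : ℝ) / 2) / (2 * L))
    (φp : (Fin d → ℝ) → (Fin d → ℝ) → ℝ)
    (hφp : ∀ x y, φp x y =
      (1 / 2) * lpNorm p (x - u0) ^ 2 - (1 / 2) * lpNorm p (y - u0) ^ 2 -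
        ∑ i, fderiv ℝ (fun v : Fin d → ℝ => (1 / 2) * lpNorm p (v - u0) ^ 2) y
            (Pi.single i 1) * (x i - y i))
    (hubar : ∀ k, IsMinOn (fun v : Fin d → ℝ =>
        (a / β) * (∑ i, F (u k) i * (v i - u k i)) + (1 / 2) * lpNorm p (v - u k) ^ 2)
      Set.univ (ubar k))
    (hnext : ∀ k, IsMinOn (fun v : Fin d → ℝ =>
        a * (∑ i, F (ubar k) i * (v i - u k i)) + φp v (u k)) Set.univ (u (k + 1)))
    (k : ℕ) :
    (1 / ((k : ℝ) + 1)) * ∑ i ∈ Finset.range (k + 1), lpNorm (p / (p - 1)) (F (u i)) ^ 2 ≤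
      16 * L ^ 2 * ((1 / 2) * lpNorm p (ustar - u0) ^ 2) / (mp ^ 2 * ((k : ℝ) + 1)) := by
  subst hβ hu0
  have hm : 0 < β := by linarith
  have hp0 : 0 < p := by linarith
  have hq0 : 0 < p / (p - 1) := div_pos hp0 (by linarith)
  have ha0 : 0 < a := by rw [ha]; positivity
  have haL : (a * L) ^ 2 = β ^ 3 / 4 := by
    have h1 : a * L = β ^ ((3 : ℝ) / 2) / 2 := by rw [ha]; field_simp
    have h2 : (β ^ ((3 : ℝ) / 2)) ^ 2 = β ^ 3 := by
      rw [← rpow_natCast, ← rpow_mul hm.le, ← rpow_natCast]; norm_num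
    rw [h1, div_pow, h2]; norm_num
  set f : (Fin d → ℝ) → ℝ := fun v => (1 / 2) * lpNorm p (v - u 0) ^ 2 with hf
  have hφ : ∀ x y, φp x y = f x - f y - fderiv ℝ f y (x - y) := by
    intro x y
    rw [hφp, ← apply_eq_sum_single]
    rfl
  have hφ_ge : ∀ x y, β / 2 * lpNorm p (x - y) ^ 2 ≤ φp x y := by
    intro x y
    have := half_lpNorm_sq_first_order hp1 hp2 (u 0) y x
    rw [← hmp] at this
    rw [hφ]
    simp only [hf]
    linarith
  have hstep : ∀ j, β ^ 2 / (16 * L ^ 2) * lpNorm (p / (p - 1)) (F (u j)) ^ 2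
      ≤ φp ustar (u j) - φp ustar (u (j + 1)) := by
    intro j
    obtain ⟨hlen, hgrow⟩ := extrapolation_step hp1 hp2 (g := (a / β) • F (u j)) (x := u j)
      (y := ubar j) (by
        convert hubar j using 3 with v
        simp [Finset.mul_sum, mul_assoc])
    rw [lpNorm_smul hq0, abs_of_pos (div_pos ha0 hm)] at hlen
    have hgrad : fderiv ℝ f (u (j + 1)) = -(a • dotCLM (F (ubar j)) - fderiv ℝ f (u j)) := by
      refine fderiv_eq_neg_of_isMinOn hp1 hp2 (w := u j) (C := -f (u j)) ?_
      convert hnext j using 2 with v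
      rw [hφ]
      simp [hf]
      ring
    have hthree : a * dotCLM (F (ubar j)) (u (j + 1) - ustar)
        = φp ustar (u j) - φp ustar (u (j + 1)) - φp (u (j + 1)) (u j) := by
      simp only [hφ, hgrad, neg_apply, sub_apply,
        smul_apply, smul_eq_mul, map_sub]
      ring
    have hmin : 0 ≤ dotCLM (F (ubar j)) (ubar j - ustar) := by
      simpa using hminty (ubar j)
    have hdec : a * dotCLM (F (ubar j)) (ubar j - ustar)
        = a * dotCLM (F (ubar j)) (u (j + 1) - ustar)
          + a * dotCLM (F (ubar j) - F (u j)) (ubar j - u (j + 1))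
          + β * dotCLM ((a / β) • F (u j)) (ubar j - u (j + 1)) := by
      simp only [dotCLM_apply, Finset.mul_sum, ← Finset.sum_add_distrib]
      refine Finset.sum_congr rfl fun i _ => ?_
      simp only [Pi.sub_apply, Pi.smul_apply, smul_eq_mul]
      field_simp
      ring
    have hcross : dotCLM (F (ubar j) - F (u j)) (ubar j - u (j + 1))
        ≤ L * lpNorm p (ubar j - u j) * lpNorm p (u (j + 1) - ubar j) := by
      rw [lpNorm_sub_comm p (u (j + 1)), dotCLM_apply]
      exact (le_abs_self _).trans ((abs_dot_le hp1 _ _).trans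
        (mul_le_mul_of_nonneg_right (hLip _ _) (lpNorm_nonneg _ _)))
    have hg := hgrow (u (j + 1))
    rw [← hmp] at hg
    have hb := hφ_ge (u (j + 1)) (u j)
    set X := lpNorm p (ubar j - u j)
    set Y := lpNorm p (u (j + 1) - ubar j)
    set Z := lpNorm p (u (j + 1) - u j)
    set N := lpNorm (p / (p - 1)) (F (u j))
    have hyoung : a * (L * X * Y) ≤ β ^ 2 / 2 * Y ^ 2 + β / 8 * X ^ 2 := by
      have h1 : β ^ 2 / 2 * (Y - a * L * X / β ^ 2) ^ 2
          = β ^ 2 / 2 * Y ^ 2 - a * (L * X * Y) + (a * L) ^ 2 * X ^ 2 / (2 * β ^ 2) := by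
        field_simp
        ring
      have h2 : (a * L) ^ 2 * X ^ 2 / (2 * β ^ 2) = β / 8 * X ^ 2 := by
        rw [haL]; field_simp; ring
      have h3 : 0 ≤ β ^ 2 / 2 * (Y - a * L * X / β ^ 2) ^ 2 := by positivity
      linarith
    have h1 := mul_nonneg ha0.le hmin
    have h2 := mul_le_mul_of_nonneg_left hcross ha0.le
    have h3 := mul_le_mul_of_nonneg_left hg hm.le
    have h4 : 3 / 8 * β * X ^ 2 ≤ φp ustar (u j) - φp ustar (u (j + 1)) := by
      linarith
    have h5 : β / 4 * X ^ 2 = β ^ 2 / (16 * L ^ 2) * N ^ 2 := by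
      have : a ^ 2 = β ^ 3 / (4 * L ^ 2) := by
        rw [eq_div_iff (by positivity)]; linarith [haL, mul_pow a L 2]
      rw [hlen, mul_pow, div_pow, this]
      field_simp
      ring
    have h6 : 0 ≤ β * X ^ 2 := by positivity
    linarith
  have hsum : ∀ n, β ^ 2 / (16 * L ^ 2) *
      ∑ i ∈ Finset.range n, lpNorm (p / (p - 1)) (F (u i)) ^ 2
        ≤ φp ustar (u 0) - φp ustar (u n) := by
    intro n
    rw [Finset.mul_sum, ← Finset.sum_range_sub' fun i => φp ustar (u i)]
    exact Finset.sum_le_sum fun i _ => hstep i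
  have hinit : φp ustar (u 0) = (1 / 2) * lpNorm p (ustar - u 0) ^ 2 := by
    have hzero_norm : lpNorm p (u 0 - u 0) = 0 := by
      simpa using lpNorm_smul hp0 0 (u 0)
    have h0 : fderiv ℝ f (u 0) = -0 := by
      refine fderiv_eq_neg_of_isMinOn hp1 hp2 (w := u 0) (C := 0) fun v _ => ?_
      simp only [Set.mem_ofPred_eq, zero_apply, hzero_norm]
      have : 0 ≤ lpNorm p (v - u 0) ^ 2 := sq_nonneg _
      linarith
    rw [hφ, h0]
    simp only [hf, hzero_norm, neg_zero, zero_apply]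
    ring
  have hfin := hsum (k + 1)
  rw [hinit] at hfin
  have hnn : 0 ≤ φp ustar (u (k + 1)) :=
    le_trans (by positivity) (hφ_ge ustar (u (k + 1)))
  have hfin' := hfin.trans (sub_le_self _ hnn)
  rw [div_mul_eq_mul_div, div_le_iff₀ (by positivity)] at hfin'
  rw [one_div_mul_eq_div, mul_comm (β ^ 2), ← div_div, div_right_comm]
  gcongr
  rw [le_div_iff₀ (by positivity)]
  linarith
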